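/- arXiv:1805.10115 — 17 statements merged into one kernel-verified Lean document; each statement's English description precedes it below -/
import Mathlib

section
/- If X* is a GESS of a continuous payoff operator C on the probability simplex, then X* is the unique symmetric Nash equilibrium strategy of C, i.e. NE⁺(C) = {X*}. -/
/-- If `Xstar` is a GESS of a continuous payoff operator `C` on the
probability simplex, then `NE⁺(C) = {Xstar}`. -/
theorem gess_unique_symmetric_equilibrium {n : ℕ}
    (C : (Fin n → ℝ) → (Fin n → ℝ))
    (hC : ContinuousOn C (stdSimplex ℝ (Fin n)))
    (Xstar : Fin n → ℝ) (hXstar : Xstar ∈ stdSimplex ℝ (Fin n))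
    (hGESS : ∀ X ∈ stdSimplex ℝ (Fin n), X ≠ Xstar →
      0 < ∑ i, (Xstar i - X i) * C X i) :
    {Y | Y ∈ stdSimplex ℝ (Fin n) ∧
      ∀ X ∈ stdSimplex ℝ (Fin n), 0 ≤ ∑ i, (Y i - X i) * C Y i} = {Xstar} := by
  ext Y
  simp only [Set.mem_setOf_eq, Set.mem_singleton_iff]
  constructor
  · rintro ⟨hY, h⟩
    by_contra hne
    have h1 := hGESS Y hY hne
    have h2 := h Xstar hXstar
    have h3 : ∑ i, (Y i - Xstar i) * C Y i = -∑ i, (Xstar i - Y i) * C Y i := by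
      rw [← Finset.sum_neg_distrib]
      exact Finset.sum_congr rfl fun i _ => by ring
    linarith
  · rintro rfl
    refine ⟨hXstar, fun X hX => ?_⟩
    let t : ℕ → ℝ := fun k => 1 / ((k : ℝ) + 1)
    let g : ℕ → Fin n → ℝ := fun k => Y + t k • (X - Y)
    have ht0 : ∀ k, 0 < t k := fun k => by positivity
    have ht1 : ∀ k, t k ≤ 1 := fun k => by
      have : (0 : ℝ) ≤ k := Nat.cast_nonneg k
      exact (div_le_one (by positivity)).2 (by linarith)
    have hg : ∀ k, g k ∈ stdSimplex ℝ (Fin n) := fun k =>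
      (convex_stdSimplex ℝ (Fin n)).add_smul_sub_mem hXstar hX ⟨(ht0 k).le, ht1 k⟩
    have hlim : Filter.Tendsto g Filter.atTop (nhds Y) := by
      have h0 : Filter.Tendsto t Filter.atTop (nhds 0) :=
        tendsto_one_div_add_atTop_nhds_zero_nat
      have := (h0.smul_const (X - Y)).const_add Y
      simpa using this
    have hClim : Filter.Tendsto (fun k => C (g k)) Filter.atTop (nhds (C Y)) :=
      (hC Y hXstar).tendsto.comp
        (tendsto_nhdsWithin_iff.2 ⟨hlim, Filter.Eventually.of_forall hg⟩)
    have hS : Filter.Tendsto (fun k => ∑ i, (Y i - X i) * C (g k) i) Filter.atTop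
        (nhds (∑ i, (Y i - X i) * C Y i)) :=
      tendsto_finsetSum _ fun i _ => ((tendsto_pi_nhds.1 hClim) i).const_mul _
    refine ge_of_tendsto' hS fun k => ?_
    by_cases hk : g k = Y
    · have hXY : ∀ i, Y i - X i = 0 := fun i => by
        have h1 : Y i + t k * (X i - Y i) = Y i := congrFun hk i
        have h2 : t k * (X i - Y i) = 0 := by linarith
        rcases mul_eq_zero.1 h2 with h | h
        · exact absurd h (ht0 k).ne'
        · linarith
      simp [hXY]
    · have h1 := hGESS (g k) (hg k) hk
      have h2 : ∑ i, (Y i - g k i) * C (g k) i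
          = t k * ∑ i, (Y i - X i) * C (g k) i := by
        rw [Finset.mul_sum]
        refine Finset.sum_congr rfl fun i _ => ?_
        have : g k i = Y i + t k * (X i - Y i) := rfl
        rw [show Y i - g k i = t k * (Y i - X i) by rw [this]; ring]
        ring
      rw [h2] at h1
      exact (pos_of_mul_pos_right h1 (ht0 k).le).le
end

section
/- For a continuous vector field F on a nonempty, closed, convex set 𝕏 ⊆ ℝⁿ, a point X* ∈ 𝕏 is a maximal element of the relation ⪰_S if and only if it is a maximal element of the relation ⊵_S. -/
/-- The strict linear polyorder `⪰_S`: `X ⪰_S Y` iff for all `ε ∈ [0,1]`,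
`X·F(Y_ε) > Y·F(Y_ε)` where `Y_ε = εY + (1-ε)X`. -/
def relS {n : ℕ} (F : (Fin n → ℝ) → (Fin n → ℝ)) (X Y : Fin n → ℝ) : Prop :=
  ∀ ε ∈ Set.Icc (0 : ℝ) 1,
    ∑ i, Y i * F (ε • Y + (1 - ε) • X) i < ∑ i, X i * F (ε • Y + (1 - ε) • X) i

/-- The strict linear polyorder `⊵_S`: `X ⊵_S Y` iff there exists `ε ∈ [0,1]` with
`X·F(Y_ε) ≥ Y·F(Y_ε)` where `Y_ε = εY + (1-ε)X`. -/
def relTS {n : ℕ} (F : (Fin n → ℝ) → (Fin n → ℝ)) (X Y : Fin n → ℝ) : Prop :=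
  ∃ ε ∈ Set.Icc (0 : ℝ) 1,
    ∑ i, Y i * F (ε • Y + (1 - ε) • X) i ≤ ∑ i, X i * F (ε • Y + (1 - ε) • X) i

/-- `x` is a maximal element of the relation `R` on the set `𝕏`. -/
def maximalOn {α : Type*} (𝕏 : Set α) (R : α → α → Prop) (x : α) : Prop :=
  ¬ ∃ y ∈ 𝕏, R y x ∧ ¬ R x y

theorem not_relTS_iff_aux {n : ℕ} (F : (Fin n → ℝ) → (Fin n → ℝ)) (X Y : Fin n → ℝ) :
    ¬ relTS F X Y ↔ relS F Y X := by
  unfold relTS relS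
  push Not
  constructor
  · intro h ε hε
    have := h (1 - ε) ⟨by linarith [hε.2], by linarith [hε.1]⟩
    rwa [sub_sub_cancel, add_comm] at this
  · intro h ε hε
    have := h (1 - ε) ⟨by linarith [hε.2], by linarith [hε.1]⟩
    rwa [sub_sub_cancel, add_comm] at this

/-- `Xstar` is `⪰_S`-maximal iff it is `⊵_S`-maximal. -/
theorem relS_maximal_iff_relTS_maximal {n : ℕ}
    (𝕏 : Set (Fin n → ℝ)) (hne : 𝕏.Nonempty) (hcl : IsClosed 𝕏) (hcv : Convex ℝ 𝕏)
    (F : (Fin n → ℝ) → (Fin n → ℝ)) (hF : ContinuousOn F 𝕏)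
    (Xstar : Fin n → ℝ) (hXstar : Xstar ∈ 𝕏) :
    maximalOn 𝕏 (relS F) Xstar ↔ maximalOn 𝕏 (relTS F) Xstar := by
  unfold maximalOn
  refine not_congr (exists_congr fun y => and_congr_right fun _ => ?_)
  rw [not_relTS_iff_aux]
  have h0 : (0 : ℝ) ∈ Set.Icc (0 : ℝ) 1 := ⟨le_rfl, zero_le_one⟩
  have h1 : (1 : ℝ) ∈ Set.Icc (0 : ℝ) 1 := ⟨zero_le_one, le_rfl⟩
  constructor
  · rintro ⟨h, -⟩
    exact ⟨⟨0, h0, (h 0 h0).le⟩, h⟩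
  · rintro ⟨-, h⟩
    refine ⟨h, fun h' => ?_⟩
    have a := h 0 h0
    have b := h' 1 h1
    simp at a b
    exact lt_asymm a b
end

section
/- For a continuous vector field F on a nonempty, closed, convex set 𝕏 ⊆ ℝⁿ, a point X* ∈ 𝕏 is a maximal element of the strict linear polyorder ⪰_S if and only if X* is a critical element of F, i.e. (X* − X)·F(X*) ≥ 0 for all X ∈ 𝕏. -/
/-- `Xstar` is `⪰_S`-maximal iff it is a critical element of `F`,
i.e. `(Xstar − X)·F(Xstar) ≥ 0` for all `X ∈ 𝕏`. -/
theorem relS_maximal_iff_critical {n : ℕ}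
    (𝕏 : Set (Fin n → ℝ)) (hne : 𝕏.Nonempty) (hcl : IsClosed 𝕏) (hcv : Convex ℝ 𝕏)
    (F : (Fin n → ℝ) → (Fin n → ℝ)) (hF : ContinuousOn F 𝕏)
    (Xstar : Fin n → ℝ) (hXstar : Xstar ∈ 𝕏) :
    maximalOn 𝕏 (relS F) Xstar ↔
      ∀ X ∈ 𝕏, 0 ≤ ∑ i, (Xstar i - X i) * F Xstar i := by
  constructor
  · intro hmax X hX
    by_contra hneg
    push Not at hneg
    apply hmax
    let p : ℝ → (Fin n → ℝ) := fun t => t • X + (1 - t) • Xstar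
    let g : ℝ → ℝ := fun t => ∑ i, (X i - Xstar i) * F (p t) i
    have hp : Set.MapsTo p (Set.Icc 0 1) 𝕏 := fun t ht =>
      hcv hX hXstar ht.1 (by linarith [ht.2]) (by ring)
    have hpc : Continuous p := by fun_prop
    have hFp : ContinuousOn (fun t => F (p t)) (Set.Icc 0 1) :=
      hF.comp hpc.continuousOn hp
    have hg : ContinuousOn g (Set.Icc 0 1) := by
      refine continuousOn_finsetSum _ fun i _ => continuousOn_const.mul ?_
      exact (continuous_apply i).comp_continuousOn hFp
    have p0 : p 0 = Xstar := by simp [p]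
    have g0 : 0 < g 0 := by
      have : g 0 = - ∑ i, (Xstar i - X i) * F Xstar i := by
        simp only [g, p0]
        rw [← Finset.sum_neg_distrib]
        exact Finset.sum_congr rfl fun i _ => by ring
      linarith
    have hev : ∀ᶠ t in nhdsWithin 0 (Set.Icc (0:ℝ) 1), 0 < g t :=
      (hg 0 (by simp)).eventually (lt_mem_nhds g0)
    obtain ⟨η, hη, hball⟩ := Metric.mem_nhdsWithin_iff.1 hev
    obtain ⟨δ, hδ0, hδ1, hδη⟩ : ∃ δ : ℝ, 0 < δ ∧ δ ≤ 1 ∧ δ < η :=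
      ⟨min (η / 2) 1, by positivity, min_le_right _ _,
        lt_of_le_of_lt (min_le_left _ _) (by linarith)⟩
    have hpos : ∀ t, 0 ≤ t → t ≤ δ → 0 < g t := fun t h0 h1 =>
      hball ⟨by rw [Metric.mem_ball, Real.dist_eq, sub_zero, abs_of_nonneg h0]; linarith,
        h0, by linarith⟩
    have key : ∀ t, ∑ i, p δ i * F (p t) i - ∑ i, Xstar i * F (p t) i = δ * g t := by
      intro t
      simp only [g]
      rw [← Finset.sum_sub_distrib, Finset.mul_sum]
      refine Finset.sum_congr rfl fun i _ => ?_
      have : p δ i = δ * X i + (1 - δ) * Xstar i := by simp [p]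
      rw [this]; ring
    refine ⟨p δ, hp ⟨hδ0.le, hδ1⟩, ?_, ?_⟩
    · intro ε hε
      have e : ε • Xstar + (1 - ε) • p δ = p ((1 - ε) * δ) := by
        ext i
        simp [p]; ring
      rw [e]
      have h1 := hpos ((1 - ε) * δ) (mul_nonneg (by linarith [hε.2]) hδ0.le)
        (by nlinarith [hε.1])
      have := mul_pos hδ0 h1
      linarith [key ((1 - ε) * δ)]
    · intro h
      have h := h 0 (by simp)
      have e : (0:ℝ) • p δ + (1 - 0 : ℝ) • Xstar = p 0 := by rw [p0]; simp
      rw [e] at h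
      have := mul_pos hδ0 g0
      linarith [key 0]
  · rintro hcrit ⟨y, hy, hR, -⟩
    have h := hR 1 (by simp)
    have e : (1:ℝ) • Xstar + (1 - 1 : ℝ) • y = Xstar := by simp
    rw [e] at h
    have h2 := hcrit y hy
    simp only [sub_mul, Finset.sum_sub_distrib] at h2
    linarith
end

section
/- For a continuous vector field F on a nonempty, closed, convex set 𝕏 ⊆ ℝⁿ, a point X* ∈ 𝕏 is a maximal element of the relation ⪰ if and only if it is a maximal element of the relation ⊵. -/
/-- The drifting linear polyorder `⪰`: `X ⪰ Y` iff for all `ε ∈ [0,1]`,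
`X·F(Y_ε) ≥ Y·F(Y_ε)` where `Y_ε = εY + (1-ε)X`. -/
def relD {n : ℕ} (F : (Fin n → ℝ) → (Fin n → ℝ)) (X Y : Fin n → ℝ) : Prop :=
  ∀ ε ∈ Set.Icc (0 : ℝ) 1,
    ∑ i, Y i * F (ε • Y + (1 - ε) • X) i ≤ ∑ i, X i * F (ε • Y + (1 - ε) • X) i

/-- The drifting linear polyorder `⊵`: `X ⊵ Y` iff there exists `ε ∈ [0,1]` with
`X·F(Y_ε) > Y·F(Y_ε)` where `Y_ε = εY + (1-ε)X`. -/
def relDT {n : ℕ} (F : (Fin n → ℝ) → (Fin n → ℝ)) (X Y : Fin n → ℝ) : Prop :=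
  ∃ ε ∈ Set.Icc (0 : ℝ) 1,
    ∑ i, Y i * F (ε • Y + (1 - ε) • X) i < ∑ i, X i * F (ε • Y + (1 - ε) • X) i

theorem relDT_iff_not_relD_aux {n : ℕ} (F : (Fin n → ℝ) → (Fin n → ℝ)) (X Y : Fin n → ℝ) :
    relDT F X Y ↔ ¬ relD F Y X := by
  have key : ∀ ε : ℝ, (1 - ε) • X + (1 - (1 - ε)) • Y = ε • Y + (1 - ε) • X := by
    intro ε
    rw [sub_sub_cancel, add_comm]
  constructor
  · rintro ⟨ε, hε, h⟩ hD
    have h2 := hD (1 - ε) ⟨by linarith [hε.2], by linarith [hε.1]⟩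
    rw [key] at h2
    exact absurd h (not_lt.mpr h2)
  · intro h
    by_contra hT
    apply h
    intro ε hε
    by_contra hlt
    apply hT
    refine ⟨1 - ε, ⟨by linarith [hε.2], by linarith [hε.1]⟩, ?_⟩
    have e : (1 - ε) • Y + (1 - (1 - ε)) • X = ε • X + (1 - ε) • Y := by
      rw [sub_sub_cancel, add_comm]
    rw [e]
    exact not_le.mp hlt

/-- `Xstar` is `⪰`-maximal iff it is `⊵`-maximal. -/
theorem relD_maximal_iff_relDT_maximal {n : ℕ}
    (𝕏 : Set (Fin n → ℝ)) (hne : 𝕏.Nonempty) (hcl : IsClosed 𝕏) (hcv : Convex ℝ 𝕏)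
    (F : (Fin n → ℝ) → (Fin n → ℝ)) (hF : ContinuousOn F 𝕏)
    (Xstar : Fin n → ℝ) (hXstar : Xstar ∈ 𝕏) :
    maximalOn 𝕏 (relD F) Xstar ↔ maximalOn 𝕏 (relDT F) Xstar := by
  unfold maximalOn
  simp only [relDT_iff_not_relD_aux, not_not, and_comm]
end

section
/- If X* is a drifting equilibrium of a continuous vector field F on a nonempty, closed, convex set 𝕏 ⊆ ℝⁿ, then X* is a critical element of F, i.e. (X* − X)·F(X*) ≥ 0 for all X ∈ 𝕏. -/
/-- if `Xstar` is a drifting equilibrium of `F` (a `⪰`-maximal element),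
then it is a critical element of `F`. -/
theorem drifting_equilibrium_is_critical {n : ℕ}
    (𝕏 : Set (Fin n → ℝ)) (hne : 𝕏.Nonempty) (hcl : IsClosed 𝕏) (hcv : Convex ℝ 𝕏)
    (F : (Fin n → ℝ) → (Fin n → ℝ)) (hF : ContinuousOn F 𝕏)
    (Xstar : Fin n → ℝ) (hXstar : Xstar ∈ 𝕏)
    (hmax : maximalOn 𝕏 (relD F) Xstar) :
    ∀ X ∈ 𝕏, 0 ≤ ∑ i, (Xstar i - X i) * F Xstar i := by
  intro X hX
  by_contra hneg
  push Not at hneg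
  have hcont : ContinuousOn (fun t : ℝ => ∑ i, (Xstar i - X i) * F (Xstar + t • (X - Xstar)) i)
      (Set.Icc 0 1) := by
    have h1 : ContinuousOn (fun t : ℝ => F (Xstar + t • (X - Xstar))) (Set.Icc 0 1) := by
      refine hF.comp (f := fun t : ℝ => Xstar + t • (X - Xstar))
        (Continuous.continuousOn (by fun_prop)) ?_
      intro t ht
      exact hcv.add_smul_sub_mem hXstar hX ht
    refine continuousOn_finsetSum _ fun i _ => ?_
    exact continuousOn_const.mul ((continuous_apply i).comp_continuousOn h1)
  have h0 := hcont 0 (by simp)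
  have hev := h0.eventually_lt_const (u := 0) (by simpa using hneg)
  rw [eventually_nhdsWithin_iff, Metric.eventually_nhds_iff] at hev
  obtain ⟨r, hr, hball⟩ := hev
  obtain ⟨d, hd0, hd1, hdr⟩ : ∃ d : ℝ, 0 < d ∧ d ≤ 1 ∧ d < r :=
    ⟨min 1 (r / 2), by positivity, min_le_left _ _,
      (min_le_right _ _).trans_lt (by linarith)⟩
  apply hmax
  refine ⟨Xstar + d • (X - Xstar), hcv.add_smul_sub_mem hXstar hX ⟨hd0.le, hd1⟩, ?_, ?_⟩
  · intro ε hε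
    have hp : ε • Xstar + (1 - ε) • (Xstar + d • (X - Xstar))
        = Xstar + ((1 - ε) * d) • (X - Xstar) := by
      ext i
      simp
      ring
    rw [hp]
    have h1 : 0 ≤ (1 - ε) * d := mul_nonneg (by linarith [hε.2]) hd0.le
    have h2 : (1 - ε) * d ≤ d := by nlinarith [hε.1]
    have hlt := hball (y := (1 - ε) * d)
      (by rw [Real.dist_eq, sub_zero, abs_of_nonneg h1]; linarith) ⟨h1, by linarith⟩
    rw [← sub_nonneg, ← Finset.sum_sub_distrib]
    have he : ∑ i, ((Xstar + d • (X - Xstar)) i * F (Xstar + ((1 - ε) * d) • (X - Xstar)) i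
        - Xstar i * F (Xstar + ((1 - ε) * d) • (X - Xstar)) i)
        = (-d) * ∑ i, (Xstar i - X i) * F (Xstar + ((1 - ε) * d) • (X - Xstar)) i := by
      rw [Finset.mul_sum]
      refine Finset.sum_congr rfl fun i _ => ?_
      simp only [Pi.add_apply, Pi.smul_apply, Pi.sub_apply, smul_eq_mul]
      ring
    rw [he]
    exact mul_nonneg_of_nonpos_of_nonpos (by linarith) hlt.le
  · intro h
    have h := h 0 (by simp)
    rw [zero_smul, zero_add, sub_zero, one_smul, ← sub_nonneg, ← Finset.sum_sub_distrib] at h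
    have he : ∑ i, (Xstar i * F Xstar i - (Xstar + d • (X - Xstar)) i * F Xstar i)
        = d * ∑ i, (Xstar i - X i) * F Xstar i := by
      rw [Finset.mul_sum]
      refine Finset.sum_congr rfl fun i _ => ?_
      simp only [Pi.add_apply, Pi.smul_apply, Pi.sub_apply, smul_eq_mul]
      ring
    rw [he] at h
    nlinarith [mul_neg_of_pos_of_neg hd0 hneg]
end

section
/- If X* is a Minty equilibrium of a continuous vector field F on a nonempty, closed, convex set 𝕏 ⊆ ℝⁿ, i.e. (X* − X)·F(X) ≥ 0 for all X ∈ 𝕏, then X* is a drifting equilibrium of F. -/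
/-- if `Xstar` is a Minty equilibrium of `F`, i.e.
`(Xstar − X)·F(X) ≥ 0` for all `X ∈ 𝕏`, then it is a drifting equilibrium of `F`. -/
theorem minty_is_drifting_equilibrium {n : ℕ}
    (𝕏 : Set (Fin n → ℝ)) (hne : 𝕏.Nonempty) (hcl : IsClosed 𝕏) (hcv : Convex ℝ 𝕏)
    (F : (Fin n → ℝ) → (Fin n → ℝ)) (hF : ContinuousOn F 𝕏)
    (Xstar : Fin n → ℝ) (hXstar : Xstar ∈ 𝕏)
    (hMinty : ∀ X ∈ 𝕏, 0 ≤ ∑ i, (Xstar i - X i) * F X i) :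
    maximalOn 𝕏 (relD F) Xstar := by
  rintro ⟨Y, hY, -, hn⟩
  apply hn
  have hmem : ∀ ε ∈ Set.Icc (0 : ℝ) 1, ε • Y + (1 - ε) • Xstar ∈ 𝕏 := fun ε hε =>
    hcv hY hXstar hε.1 (by linarith [hε.2]) (by ring)
  have hcont : ContinuousOn
      (fun ε : ℝ => ∑ i, (Xstar i - Y i) * F (ε • Y + (1 - ε) • Xstar) i) (Set.Icc 0 1) := by
    have h1 : ContinuousOn (fun ε : ℝ => F (ε • Y + (1 - ε) • Xstar)) (Set.Icc 0 1) :=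
      hF.comp (by fun_prop) hmem
    refine continuousOn_finsetSum _ fun i _ => ?_
    exact continuousOn_const.mul (continuousOn_pi.1 h1 i)
  have hpos : ∀ ε ∈ Set.Ioc (0 : ℝ) 1,
      0 ≤ ∑ i, (Xstar i - Y i) * F (ε • Y + (1 - ε) • Xstar) i := by
    intro ε hε
    have h := hMinty _ (hmem ε ⟨hε.1.le, hε.2⟩)
    have e : ∑ i, (Xstar i - (ε • Y + (1 - ε) • Xstar) i) * F (ε • Y + (1 - ε) • Xstar) i
        = ε * ∑ i, (Xstar i - Y i) * F (ε • Y + (1 - ε) • Xstar) i := by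
      rw [Finset.mul_sum]
      refine Finset.sum_congr rfl fun i _ => ?_
      have : (ε • Y + (1 - ε) • Xstar) i = ε * Y i + (1 - ε) * Xstar i := by simp
      rw [this]; ring
    rw [e] at h
    exact nonneg_of_mul_nonneg_right h hε.1
  intro ε' hε'
  have key : ∀ ε ∈ Set.Icc (0 : ℝ) 1,
      0 ≤ ∑ i, (Xstar i - Y i) * F (ε • Y + (1 - ε) • Xstar) i := by
    intro ε hε
    refine ContinuousWithinAt.closure_le (s := Set.Ioc (0 : ℝ) 1) (f := fun _ => (0 : ℝ)) ?_
      continuousWithinAt_const ((hcont ε hε).mono Set.Ioc_subset_Icc_self) hpos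
    rw [closure_Ioc (by norm_num)]
    exact hε
  have h := key ε' hε'
  simp only [sub_mul, Finset.sum_sub_distrib] at h
  linarith
end

section
/- Let C be an n×n real matrix defining the symmetric bimatrix game (C, Cᵀ) over the probability simplex 𝕏 ⊆ ℝⁿ. Then X* ∈ 𝕏 is a maximal element of the drifting linear polyorder of the vector field X ↦ CX if and only if X* is a neutrally stable strategy (NSS) of (C, Cᵀ). -/
theorem relD_iff_aux {n : ℕ} (C : Matrix (Fin n) (Fin n) ℝ)
    (B : (Fin n → ℝ) →ₗ[ℝ] (Fin n → ℝ) →ₗ[ℝ] ℝ)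
    (hB : ∀ x y, B x y = ∑ i, x i * C.mulVec y i) (X Y : Fin n → ℝ) :
    (relD (fun X => C.mulVec X) Y X ↔
      ∀ t ∈ Set.Icc (0 : ℝ) 1, 0 ≤ B (Y - X) X + t * B (Y - X) (Y - X)) ∧
    (relD (fun X => C.mulVec X) X Y ↔
      ∀ t ∈ Set.Icc (0 : ℝ) 1, B (Y - X) X + t * B (Y - X) (Y - X) ≤ 0) := by
  constructor
  · unfold relD
    simp only [← hB]
    constructor
    · intro h t ht
      have := h (1 - t) ⟨by linarith [ht.2], by linarith [ht.1]⟩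
      simp only [map_add, map_sub, map_smul, smul_eq_mul, LinearMap.sub_apply] at this ⊢
      linarith
    · intro h t ht
      have := h (1 - t) ⟨by linarith [ht.2], by linarith [ht.1]⟩
      simp only [map_add, map_sub, map_smul, smul_eq_mul, LinearMap.sub_apply] at this ⊢
      linarith
  · unfold relD
    simp only [← hB]
    constructor
    · intro h t ht
      have := h t ht
      simp only [map_add, map_sub, map_smul, smul_eq_mul, LinearMap.sub_apply] at this ⊢
      linarith
    · intro h t ht
      have := h t ht
      simp only [map_add, map_sub, map_smul, smul_eq_mul, LinearMap.sub_apply] at this ⊢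
      linarith

theorem exists_B_aux {n : ℕ} (C : Matrix (Fin n) (Fin n) ℝ) :
    ∃ B : (Fin n → ℝ) →ₗ[ℝ] (Fin n → ℝ) →ₗ[ℝ] ℝ,
      ∀ x y, B x y = ∑ i, x i * C.mulVec y i := by
  refine ⟨LinearMap.mk₂ ℝ (fun x y => x ⬝ᵥ (C.mulVec y)) ?_ ?_ ?_ ?_, fun x y => rfl⟩
  · intro a b c; exact add_dotProduct _ _ _
  · intro a b c; exact smul_dotProduct _ _ _
  · intro a b c; rw [Matrix.mulVec_add, dotProduct_add]
  · intro a b c; rw [Matrix.mulVec_smul, dotProduct_smul]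

theorem maximal_facts_aux {n : ℕ} (C : Matrix (Fin n) (Fin n) ℝ)
    (B : (Fin n → ℝ) →ₗ[ℝ] (Fin n → ℝ) →ₗ[ℝ] ℝ)
    (hB : ∀ x y, B x y = ∑ i, x i * C.mulVec y i) (X : Fin n → ℝ)
    (hX : X ∈ stdSimplex ℝ (Fin n))
    (hm : maximalOn (stdSimplex ℝ (Fin n)) (relD (fun X => C.mulVec X)) X)
    (Y : Fin n → ℝ) (hY : Y ∈ stdSimplex ℝ (Fin n)) :
    B (Y - X) X ≤ 0 ∧ (B (Y - X) X = 0 → B (Y - X) (Y - X) ≤ 0) := by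
  have key : ∀ Z ∈ stdSimplex ℝ (Fin n),
      (∀ t ∈ Set.Icc (0 : ℝ) 1, 0 ≤ B (Z - X) X + t * B (Z - X) (Z - X)) →
      (∀ t ∈ Set.Icc (0 : ℝ) 1, B (Z - X) X + t * B (Z - X) (Z - X) ≤ 0) := by
    intro Z hZ h
    by_contra hc
    exact hm ⟨Z, hZ, (relD_iff_aux C B hB X Z).1.2 h,
      fun h' => hc ((relD_iff_aux C B hB X Z).2.1 h')⟩
  constructor
  · by_contra! ha
    set a := B (Y - X) X with hadef
    set b := B (Y - X) (Y - X) with hbdef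
    have hden : 0 < a + |b| := by positivity
    set s := a / (a + |b|) with hs
    have hs0 : 0 < s := by positivity
    have hs1 : s ≤ 1 := by
      rw [hs, div_le_one hden]; linarith [abs_nonneg b]
    have hsb : s * |b| ≤ a := by
      rw [hs, div_mul_eq_mul_div, div_le_iff₀ hden]
      nlinarith
    have hZ : X + s • (Y - X) ∈ stdSimplex ℝ (Fin n) :=
      (convex_stdSimplex ℝ (Fin n)).add_smul_sub_mem hX hY ⟨hs0.le, hs1⟩
    have hk := key _ hZ
    simp only [add_sub_cancel_left, map_smul, LinearMap.smul_apply, smul_eq_mul, ← hadef,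
      ← hbdef] at hk
    have h0 := hk (by
      intro t ht
      have h1 : t * (s * |b|) ≤ a := by
        have : 0 ≤ s * |b| := by positivity
        nlinarith [ht.1, ht.2]
      have h2 : -(t * (s * |b|)) ≤ t * (s * b) := by
        have h3 : 0 ≤ t * s := mul_nonneg ht.1 hs0.le
        nlinarith [neg_abs_le b]
      have : 0 ≤ s * (a + t * (s * b)) := mul_nonneg hs0.le (by linarith)
      linarith) 0 ⟨le_rfl, zero_le_one⟩
    have := mul_pos hs0 ha
    linarith
  · intro ha
    by_contra! hb
    have := key Y hY (fun t ht => by rw [ha]; nlinarith [mul_nonneg ht.1 hb.le]) 1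
      ⟨zero_le_one, le_rfl⟩
    linarith

/-- in a symmetric bimatrix game `(C, Cᵀ)`, `Xstar` is a maximal
element of the drifting linear polyorder of `X ↦ CX` iff `Xstar` is a neutrally
stable strategy (NSS) of `(C, Cᵀ)`. -/
theorem drifting_maximal_iff_NSS {n : ℕ} (C : Matrix (Fin n) (Fin n) ℝ)
    (Xstar : Fin n → ℝ) (hXstar : Xstar ∈ stdSimplex ℝ (Fin n)) :
    maximalOn (stdSimplex ℝ (Fin n)) (relD (fun X => C.mulVec X)) Xstar ↔
      ∃ O : Set (Fin n → ℝ), IsOpen O ∧ Xstar ∈ O ∧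
        ∀ X ∈ O ∩ stdSimplex ℝ (Fin n), X ≠ Xstar →
          0 ≤ ∑ i, (Xstar i - X i) * C.mulVec X i := by
  obtain ⟨B, hB⟩ := exists_B_aux C
  have hgoal : ∀ X : Fin n → ℝ, ∑ i, (Xstar i - X i) * C.mulVec X i
      = - (B (X - Xstar) Xstar + B (X - Xstar) (X - Xstar)) := by
    intro X
    have : ∑ i, (Xstar i - X i) * C.mulVec X i = B (Xstar - X) X := by
      rw [hB]; rfl
    rw [this]
    simp only [map_sub, LinearMap.sub_apply]
    ring
  simp only [hgoal]
  constructor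
  · intro hm
    have facts := maximal_facts_aux C B hB Xstar hXstar hm
    set v : Fin n → (Fin n → ℝ) := fun i => Pi.single i 1 - Xstar with hv
    set u : Fin n → ℝ := fun i => B (v i) Xstar with hu
    have hu0 : ∀ i, u i ≤ 0 := fun i => (facts _ (single_mem_stdSimplex ℝ i)).1
    have hsumv : ∀ c : Fin n → ℝ, ∑ i, c i • v i = c - (∑ i, c i) • Xstar := by
      intro c
      simp only [hv, smul_sub, Finset.sum_sub_distrib, ← Finset.sum_smul]
      congr 1
      ext j
      simp [Finset.sum_apply, Pi.single_apply]
    classical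
    set w : (Fin n → ℝ) → Fin n → ℝ := fun Y i => if u i = 0 then 0 else Y i with hw
    have hwX : w Xstar = 0 := by
      have h0 : ∑ i, Xstar i * u i = 0 := by
        have h1 := hsumv Xstar
        rw [hXstar.2, one_smul, sub_self] at h1
        have h2 := congrArg (fun z => B z Xstar) h1
        simpa [map_sum, LinearMap.sum_apply] using h2
      have h1 := (Finset.sum_eq_zero_iff_of_nonpos (fun i _ =>
        mul_nonpos_of_nonneg_of_nonpos (hXstar.1 i) (hu0 i))).1 h0
      ext i
      by_cases hi : u i = 0
      · simp [hw, hi]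
      · have := h1 i (Finset.mem_univ i)
        simp only [hw, hi, if_false]
        simpa [hi] using this
    have hwc : Continuous w := by
      refine continuous_pi fun i => ?_
      by_cases hi : u i = 0
      · simp only [hw, hi, if_true]; exact continuous_const
      · simp only [hw, hi, if_false]; exact continuous_apply i
    set E : (Fin n → ℝ) → (Fin n → ℝ) := fun Y => ∑ i, w Y i • v i with hE
    have hEc : Continuous E := by
      refine continuous_finsetSum _ fun i _ => ?_
      exact ((continuous_apply i).comp hwc).smul continuous_const
    have hEX : E Xstar = 0 := by simp [hE, hwX]
    have hev : ∀ᶠ Y in nhds Xstar, ∀ i, u i ≠ 0 →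
        u i + B (v i) (Y - Xstar) + B (Y - Xstar - E Y) (v i) < 0 := by
      rw [Filter.eventually_all]
      intro i
      by_cases hi : u i = 0
      · simp [hi]
      · have c1 : Continuous (fun z => B (v i) z) := (B (v i)).continuous_of_finiteDimensional
        have c2 : Continuous (fun z => B z (v i)) :=
          (B.flip (v i)).continuous_of_finiteDimensional
        have hc : Continuous (fun Y =>
            u i + B (v i) (Y - Xstar) + B (Y - Xstar - E Y) (v i)) :=
          (continuous_const.add (c1.comp (continuous_id.sub continuous_const))).add
            (c2.comp ((continuous_id.sub continuous_const).sub hEc))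
        have := hc.continuousAt.eventually_lt (x₀ := Xstar)
          (continuousAt_const (y := (0 : ℝ))) (by
            simp only [sub_self, hEX, map_zero, LinearMap.zero_apply, add_zero]
            exact lt_of_le_of_ne (hu0 i) hi)
        exact this.mono fun Y hY _ => hY
    obtain ⟨O, hO, hOo, hXO⟩ := mem_nhds_iff.1 hev
    refine ⟨O, hOo, hXO, ?_⟩
    rintro Y ⟨hYO, hY⟩ -
    have hneg := hO hYO
    simp only [Set.mem_ofPred_eq] at hneg
    have hw0 : ∀ i, 0 ≤ w Y i := by
      intro i; simp only [hw]; split_ifs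
      · exact le_rfl
      · exact hY.1 i
    have hwY : ∀ i, w Y i ≤ Y i := by
      intro i; simp only [hw]; split_ifs
      · exact hY.1 i
      · exact le_rfl
    have hd : Y - Xstar = ∑ i, Y i • v i := by
      rw [hsumv, hY.2, one_smul]
    have hEY : E Y = w Y - (∑ i, w Y i) • Xstar := hsumv _
    have hY0 : Y - E Y ∈ stdSimplex ℝ (Fin n) := by
      rw [hEY]
      constructor
      · intro i
        have := mul_nonneg (Finset.sum_nonneg fun i (_ : i ∈ Finset.univ) => hw0 i) (hXstar.1 i)
        simp only [Pi.sub_apply, Pi.smul_apply, smul_eq_mul]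
        linarith [hwY i]
      · simp only [Pi.sub_apply, Pi.smul_apply, smul_eq_mul, Finset.sum_sub_distrib,
          ← Finset.mul_sum, hXstar.2, hY.2]
        ring
    have hBd : B (Y - Xstar) Xstar = ∑ i, Y i * u i := by
      rw [hd]; simp [map_sum, LinearMap.sum_apply, hu]
    have hBE : B (E Y) Xstar = ∑ i, w Y i * u i := by
      simp [hE, map_sum, LinearMap.sum_apply, hu]
    have hsame : B (Y - Xstar) Xstar = B (E Y) Xstar := by
      rw [hBd, hBE]
      refine Finset.sum_congr rfl fun i _ => ?_
      by_cases hi : u i = 0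
      · simp [hi]
      · simp [hw, hi]
    have hz : Y - E Y - Xstar = Y - Xstar - E Y := by abel
    have hb := (facts _ hY0).2
    rw [hz] at hb
    have hb' := hb (by rw [map_sub, LinearMap.sub_apply, hsame, sub_self])
    have h1 : B (E Y) (Y - Xstar) = ∑ i, w Y i * B (v i) (Y - Xstar) := by
      simp only [hE, map_sum, LinearMap.sum_apply, map_smul, LinearMap.smul_apply, smul_eq_mul]
    have h2 : ∀ z, B z (E Y) = ∑ i, w Y i * B z (v i) := by
      intro z
      simp only [hE, map_sum, map_smul, smul_eq_mul]
    have h3 : B (Y - Xstar) (Y - Xstar) = B (Y - Xstar - E Y) (Y - Xstar - E Y)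
        + B (E Y) (Y - Xstar) + B (Y - Xstar - E Y) (E Y) := by
      generalize Y - Xstar = d
      simp only [map_sub, LinearMap.sub_apply]
      ring
    have h4 : ∑ i, w Y i * (u i + B (v i) (Y - Xstar) + B (Y - Xstar - E Y) (v i)) ≤ 0 := by
      refine Finset.sum_nonpos fun i _ => ?_
      by_cases hi : u i = 0
      · simp [hw, hi]
      · exact mul_nonpos_of_nonneg_of_nonpos (hw0 i) (hneg i hi).le
    simp only [mul_add, Finset.sum_add_distrib] at h4
    rw [← hBE, ← h1, ← h2] at h4
    linarith
  · rintro ⟨O, hO, hXO, h⟩ ⟨Y, hY, h1, h2⟩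
    rw [(relD_iff_aux C B hB Xstar Y).1] at h1
    rw [(relD_iff_aux C B hB Xstar Y).2] at h2
    apply h2
    have hne : Y ≠ Xstar := by
      rintro rfl
      exact h2 (by simp)
    have hc : Continuous (fun s : ℝ => Xstar + s • (Y - Xstar)) := by fun_prop
    have hO' : (fun s : ℝ => Xstar + s • (Y - Xstar)) ⁻¹' O ∈ nhds (0 : ℝ) :=
      (hO.preimage hc).mem_nhds (by simpa using hXO)
    obtain ⟨δ, hδ, hball⟩ := Metric.mem_nhds_iff.1 hO'
    set a := B (Y - Xstar) Xstar with hadef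
    set b := B (Y - Xstar) (Y - Xstar) with hbdef
    have hs : ∀ s : ℝ, 0 < s → s < δ → s ≤ 1 → a + s * b ≤ 0 := by
      intro s hs0 hsδ hs1
      have hmem : Xstar + s • (Y - Xstar) ∈ O := by
        apply hball
        simpa [abs_of_pos hs0] using hsδ
      have hZ : Xstar + s • (Y - Xstar) ∈ stdSimplex ℝ (Fin n) :=
        (convex_stdSimplex ℝ (Fin n)).add_smul_sub_mem hXstar hY ⟨hs0.le, hs1⟩
      have := h _ ⟨hmem, hZ⟩ (by
        simp [hs0.ne', sub_eq_zero, hne])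
      simp only [add_sub_cancel_left, map_smul, LinearMap.smul_apply, smul_eq_mul, ← hadef,
        ← hbdef] at this
      have h5 : s * (a + s * b) ≤ 0 := by linarith
      exact nonpos_of_mul_nonpos_right h5 hs0
    have ha : 0 ≤ a := by simpa using h1 0 ⟨le_rfl, zero_le_one⟩
    have hab : 0 ≤ a + b := by simpa using h1 1 ⟨zero_le_one, le_rfl⟩
    set s := min (δ / 2) (1 / 2) with hsdef
    have hs0 : 0 < s := by positivity
    have hs2 : s ≤ 1 / 2 := min_le_right _ _
    have hs3 : s ≤ δ / 2 := min_le_left _ _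
    have hk := hs s hs0 (by linarith) (by linarith)
    have ha0 : a = 0 := by nlinarith
    have hb0 : b = 0 := by
      rw [ha0] at hk hab
      nlinarith
    intro t _
    rw [ha0, hb0]; simp
end

section
/- A finite strategic-form game Γ is an ordinal potential game if and only if Γ's ordinal deployment graph is ordinally acyclic, i.e. every arc of the ordinal deployment graph joining two communicating states is neutral. -/
/-- Arc of the ordinal deployment graph: a weakly profitable (not harmful)
unilateral deviation. -/
def ordArc {I : Type*} {S : I → Type*} (u : ∀ _ : I, (∀ j, S j) → ℝ)
    (s s' : ∀ j, S j) : Prop :=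
  ∃ i, (∀ j, j ≠ i → s' j = s j) ∧ u i s ≤ u i s'

/-- `P` is an ordinal potential for the game with payoffs `u`. -/
def IsOrdinalPotential {I : Type*} [DecidableEq I] {S : I → Type*}
    (u : ∀ _ : I, (∀ j, S j) → ℝ) (P : (∀ j, S j) → ℝ) : Prop :=
  ∀ (i : I) (σ : ∀ j, S j) (a b : S i),
    (u i (Function.update σ i b) < u i (Function.update σ i a) ↔
      P (Function.update σ i b) < P (Function.update σ i a))

/-- The ordinal deployment graph is ordinally acyclic: every arc of the ordinal
deployment graph joining two communicating states is neutral. -/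
def OrdinallyAcyclic {I : Type*} [DecidableEq I] {S : I → Type*}
    (u : ∀ _ : I, (∀ j, S j) → ℝ) : Prop :=
  ∀ (s : ∀ j, S j) (i : I) (a : S i),
    u i s ≤ u i (Function.update s i a) →
    Relation.ReflTransGen (ordArc u) (Function.update s i a) s →
    u i (Function.update s i a) = u i s

/-- a finite strategic-form game is an ordinal potential game iff its
ordinal deployment graph is ordinally acyclic. -/
theorem ordinal_potential_iff_ordinally_acyclic
    {I : Type*} [Fintype I] [DecidableEq I] (S : I → Type*)
    [∀ i, Fintype (S i)] [∀ i, Nonempty (S i)]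
    (u : ∀ _ : I, (∀ j, S j) → ℝ) :
    (∃ P : (∀ j, S j) → ℝ, IsOrdinalPotential u P) ↔ OrdinallyAcyclic u := by
  classical
  constructor
  · rintro ⟨P, hP⟩ s i a hle hreach
    have mono : ∀ x y, ordArc u x y → P x ≤ P y := by
      rintro x y ⟨k, hk, hu⟩
      have hy : Function.update x k (y k) = y := by
        funext j
        by_cases h : j = k
        · subst h; simp
        · simp [h, hk j h]
      have h := hP k x (x k) (y k)
      rw [hy, Function.update_eq_self] at h
      by_contra hlt
      exact absurd (h.2 (not_le.1 hlt)) (not_lt.2 hu)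
    have mono' : ∀ x y, Relation.ReflTransGen (ordArc u) x y → P x ≤ P y := by
      intro x y h
      induction h with
      | refl => exact le_rfl
      | tail _ h ih => exact ih.trans (mono _ _ h)
    by_contra hne
    have hlt := lt_of_le_of_ne hle (Ne.symm hne)
    have h := hP i s a (s i)
    rw [Function.update_eq_self] at h
    exact absurd (h.1 hlt) (not_lt.2 (mono' _ _ hreach))
  · intro hA
    have arc : ∀ (i : I) (σ : ∀ j, S j) (a b : S i),
        u i (Function.update σ i b) ≤ u i (Function.update σ i a) →
        ordArc u (Function.update σ i b) (Function.update σ i a) := by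
      intro i σ a b h
      exact ⟨i, fun j hj => by simp [hj], h⟩
    have sub : ∀ x y, ordArc u x y →
        {t | Relation.ReflTransGen (ordArc u) t x} ⊆
          {t | Relation.ReflTransGen (ordArc u) t y} :=
      fun x y h t ht => Relation.ReflTransGen.tail ht h
    refine ⟨fun s => (Set.ncard {t | Relation.ReflTransGen (ordArc u) t s} : ℝ), ?_⟩
    intro i σ a b
    simp only [Nat.cast_lt]
    constructor
    · intro h
      refine Set.ncard_lt_ncard ⟨sub _ _ (arc i σ a b h.le), fun hsub => ?_⟩ (Set.toFinite _)
      have hr := hsub (Relation.ReflTransGen.refl (a := Function.update σ i a))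
      have := hA (Function.update σ i b) i a (by simpa using h.le) (by simpa using hr)
      simp only [Function.update_idem] at this
      exact h.ne' this
    · intro h
      by_contra hn
      exact absurd h (not_lt.2
        (Set.ncard_le_ncard (sub _ _ (arc i σ b a (not_lt.1 hn))) (Set.toFinite _)))
end

section
/- Every stag hunt is a weakly acyclic game: from every strategy profile there exists a finite sequence of strictly profitable unilateral deviations ending at a pure Nash equilibrium. -/
/-- Arc of the strict deployment graph: a strictly profitable unilateral deviation. -/
def strictArc {I : Type*} {S : I → Type*} (u : ∀ _ : I, (∀ j, S j) → ℝ)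
    (s s' : ∀ j, S j) : Prop :=
  ∃ i, (∀ j, j ≠ i → s' j = s j) ∧ u i s < u i s'

/-- `s` is a pure Nash equilibrium of the game with payoffs `u`. -/
def IsPureNash {I : Type*} {S : I → Type*} (u : ∀ _ : I, (∀ j, S j) → ℝ)
    (s : ∀ j, S j) : Prop :=
  ∀ (i : I) (s' : ∀ j, S j), (∀ j, j ≠ i → s' j = s j) → u i s' ≤ u i s

/-- every stag hunt (players `Fin n`, common strategy set `Bool` with
`true = A` (hunt deer) and `false = D` (hunt hare), payoff `f i k` to an `A`-player
`i` when `k` players play `A` with `f i` strictly increasing on `{1,…,n}`, payoff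
`c` to any `D`-player, `f i n > c` and `f i 1 < c`) is weakly acyclic: from every
profile there is a finite sequence of strictly profitable unilateral deviations
reaching a pure Nash equilibrium. -/
theorem stag_hunt_weakly_acyclic {n : ℕ}
    (u : ∀ _ : Fin n, (Fin n → Bool) → ℝ) (c : ℝ) (f : Fin n → ℕ → ℝ)
    (hmono : ∀ i, StrictMonoOn (f i) (Set.Icc 1 n))
    (huA : ∀ (i : Fin n) (s : Fin n → Bool), s i = true →
      u i s = f i ((Finset.univ.filter fun j => s j = true).card))
    (huD : ∀ (i : Fin n) (s : Fin n → Bool), s i = false → u i s = c)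
    (htop : ∀ i, c < f i n) (hbot : ∀ i, f i 1 < c) :
    ∀ s : Fin n → Bool, ∃ t : Fin n → Bool,
      Relation.ReflTransGen (strictArc u) s t ∧ IsPureNash u t := by
  have hcard : ∀ (i : Fin n) (s s' : Fin n → Bool), (∀ j, j ≠ i → s' j = s j) →
      s i = false → s' i = true →
      (Finset.univ.filter fun j => s' j = true).card =
        (Finset.univ.filter fun j => s j = true).card + 1 := by
    intro i s s' h h0 h1
    have : (Finset.univ.filter fun j => s' j = true) =
        insert i (Finset.univ.filter fun j => s j = true) := by
      ext j
      by_cases hj : j = i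
      · subst hj; simp [h1]
      · simp [h j hj, hj]
    rw [this, Finset.card_insert_of_notMem (by simp [h0])]
  have hle : ∀ s : Fin n → Bool, (Finset.univ.filter fun j => s j = true).card ≤ n := by
    intro s
    simpa using Finset.card_le_univ (Finset.univ.filter fun j => s j = true)
  have hup : ∀ (m : ℕ) (s : Fin n → Bool),
      n - (Finset.univ.filter fun j => s j = true).card = m →
      (∀ i, s i = true → c ≤ u i s) →
      ∃ t : Fin n → Bool, Relation.ReflTransGen (strictArc u) s t ∧ IsPureNash u t := by
    intro m
    induction m using Nat.strong_induction_on with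
    | _ m ih =>
      intro s hm hs
      by_cases hN : IsPureNash u s
      · exact ⟨s, .refl, hN⟩
      unfold IsPureNash at hN
      push Not at hN
      obtain ⟨i, s', hd, hlt⟩ := hN
      have hi : s i = false := by
        by_contra hc
        have hc : s i = true := by simpa using hc
        cases h' : s' i with
        | true =>
          have : s' = s := by
            funext j
            by_cases hj : j = i
            · subst hj; rw [h', hc]
            · exact hd j hj
          rw [this] at hlt
          exact lt_irrefl _ hlt
        | false =>
          rw [huD i s' h'] at hlt
          exact absurd (hs i hc) (not_le.mpr hlt)
      have hi' : s' i = true := by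
        by_contra hc
        have hc : s' i = false := by simpa using hc
        rw [huD i s' hc, huD i s hi] at hlt
        exact lt_irrefl _ hlt
      have hk := hcard i s s' hd hi hi'
      have hl := hle s'
      obtain ⟨t, ht, hn⟩ := ih _ (by omega) s' rfl (by
        intro j hj
        by_cases hji : j = i
        · subst hji
          rw [huD j s hi] at hlt
          exact hlt.le
        · have hsj : s j = true := by rw [← hd j hji, hj]
          have h1 := hs j hsj
          rw [huA j s hsj] at h1
          rw [huA j s' hj, hk]
          have hpos : 0 < (Finset.univ.filter fun j => s j = true).card :=
            Finset.card_pos.mpr ⟨j, by simp [hsj]⟩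
          exact h1.trans (hmono j (Set.mem_Icc.mpr ⟨by omega, by omega⟩)
            (Set.mem_Icc.mpr ⟨by omega, by omega⟩) (Nat.lt_succ_self _)).le)
      exact ⟨t, .head ⟨i, hd, hlt⟩ ht, hn⟩
  have hdown : ∀ (m : ℕ) (s : Fin n → Bool),
      (Finset.univ.filter fun j => s j = true).card = m →
      ∃ t : Fin n → Bool, Relation.ReflTransGen (strictArc u) s t ∧ IsPureNash u t := by
    intro m
    induction m using Nat.strong_induction_on with
    | _ m ih =>
      intro s hm
      by_cases hs : ∀ i, s i = true → c ≤ u i s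
      · exact hup _ s rfl hs
      push Not at hs
      obtain ⟨i, hi, hlt⟩ := hs
      have hd : ∀ j, j ≠ i → Function.update s i false j = s j := fun j hj => by simp [hj]
      have hk := hcard i (Function.update s i false) s (fun j hj => (hd j hj).symm)
        (by simp) hi
      obtain ⟨t, ht, hn⟩ := ih _ (by omega) (Function.update s i false) rfl
      refine ⟨t, .head ⟨i, hd, ?_⟩ ht, hn⟩
      rw [huD i (Function.update s i false) (by simp)]
      exact hlt
  exact fun s => hdown _ s rfl
end

section
/- For any learning rate α > 0, a point X of the probability simplex is a fixed point of the Hedge map T (i.e. T(X) = X) if and only if X is a pure strategy or (CX)_i = (CX)_j for all i, j in the support of X. -/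
/-- The Hedge map with payoff operator `C` and learning rate `α`. -/
noncomputable def hedge {n : ℕ} (C : (Fin n → ℝ) → (Fin n → ℝ)) (α : ℝ)
    (X : Fin n → ℝ) : Fin n → ℝ :=
  fun i => X i * Real.exp (α * C X i) / ∑ j, X j * Real.exp (α * C X j)

/-- for any learning rate `α > 0`, a point `X` of the probability
simplex is a fixed point of the Hedge map iff `X` is a pure strategy or `(CX)_i`
is constant over the support of `X`. -/
theorem hedge_fixed_point_iff {n : ℕ}
    (C : (Fin n → ℝ) → (Fin n → ℝ)) (hC : ContinuousOn C (stdSimplex ℝ (Fin n)))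
    (α : ℝ) (hα : 0 < α) (X : Fin n → ℝ) (hX : X ∈ stdSimplex ℝ (Fin n)) :
    hedge C α X = X ↔
      ((∃ i, ∀ j, j ≠ i → X j = 0) ∨
        ∀ i, 0 < X i → ∀ j, 0 < X j → C X i = C X j) := by
  obtain ⟨h0, h1⟩ := hX
  have hex : ∃ i, 0 < X i := by
    by_contra! h
    have : ∑ i, X i ≤ 0 := Finset.sum_nonpos (fun i _ => h i)
    linarith
  obtain ⟨k, hk⟩ := hex
  have hS : 0 < ∑ j, X j * Real.exp (α * C X j) :=
    Finset.sum_pos' (fun i _ => mul_nonneg (h0 i) (Real.exp_pos _).le)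
      ⟨k, Finset.mem_univ _, mul_pos hk (Real.exp_pos _)⟩
  constructor
  · intro h
    right
    have key : ∀ i, 0 < X i →
        Real.exp (α * C X i) = ∑ j, X j * Real.exp (α * C X j) := by
      intro i hi
      have h2 : X i * Real.exp (α * C X i) / ∑ j, X j * Real.exp (α * C X j) = X i :=
        congrFun h i
      rw [div_eq_iff hS.ne'] at h2
      exact mul_left_cancel₀ hi.ne' h2
    intro i hi j hj
    have h3 := Real.exp_injective ((key i hi).trans (key j hj).symm)
    exact mul_left_cancel₀ hα.ne' h3
  · intro h
    have hc : ∀ i, 0 < X i → ∀ j, 0 < X j → C X i = C X j := by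
      rcases h with ⟨i, hi⟩ | h
      · intro a ha b hb
        have h4 : a = i := by
          by_contra hne
          exact ha.ne' (hi a hne)
        have h5 : b = i := by
          by_contra hne
          exact hb.ne' (hi b hne)
        rw [h4, h5]
      · exact h
    have hterm : ∀ j, X j * Real.exp (α * C X j) = X j * Real.exp (α * C X k) := by
      intro j
      rcases (h0 j).eq_or_lt with h6 | h6
      · rw [← h6]; simp
      · rw [hc j h6 k hk]
    funext i
    change X i * Real.exp (α * C X i) / ∑ j, X j * Real.exp (α * C X j) = X i
    rw [div_eq_iff hS.ne', Finset.sum_congr rfl (fun j _ => hterm j), ← Finset.sum_mul, h1,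
      one_mul, hterm i]
end

section
/- Hedge is a better response dynamic: if X lies in the relative interior of the probability simplex and X is not a fixed point of the Hedge map T with learning rate α > 0, then T(X)·CX > X·CX. -/
/-- Hedge is a better response dynamic: if `X` lies in the relative
interior of the simplex and is not a fixed point of the Hedge map with learning
rate `α > 0`, then `T(X)·CX > X·CX`. -/
theorem hedge_better_response {n : ℕ}
    (C : (Fin n → ℝ) → (Fin n → ℝ)) (hC : ContinuousOn C (stdSimplex ℝ (Fin n)))
    (α : ℝ) (hα : 0 < α) (X : Fin n → ℝ) (hX : X ∈ stdSimplex ℝ (Fin n))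
    (hint : ∀ i, 0 < X i) (hfix : hedge C α X ≠ X) :
    ∑ i, X i * C X i < ∑ i, hedge C α X i * C X i := by
  have hsum : ∑ i, X i = 1 := hX.2
  have hne : (Finset.univ : Finset (Fin n)).Nonempty := by
    by_contra h
    rw [Finset.not_nonempty_iff_eq_empty] at h
    rw [h] at hsum
    simp at hsum
  have hS : 0 < ∑ j, X j * Real.exp (α * C X j) :=
    Finset.sum_pos (fun j _ => mul_pos (hint j) (Real.exp_pos _)) hne
  have hT1 : ∑ i, hedge C α X i = 1 := by
    simp only [hedge]
    rw [← Finset.sum_div]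
    exact div_self hS.ne'
  obtain ⟨m, hm⟩ : ∃ m : ℝ, ∑ j, X j * Real.exp (α * C X j) = Real.exp (α * m) := by
    refine ⟨Real.log (∑ j, X j * Real.exp (α * C X j)) / α, ?_⟩
    rw [mul_div_cancel₀ _ hα.ne', Real.exp_log hS]
  have hT : ∀ i, hedge C α X i = X i * Real.exp (α * (C X i - m)) := by
    intro i
    simp only [hedge]
    rw [hm, mul_sub, Real.exp_sub, mul_div_assoc]
  have hpos : ∀ i, C X i ≠ m → 0 < (hedge C α X i - X i) * (C X i - m) := by
    intro i hi
    rw [hT i]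
    have hx := hint i
    have e : X i * Real.exp (α * (C X i - m)) - X i
        = X i * (Real.exp (α * (C X i - m)) - 1) := by ring
    rw [e]
    rcases lt_or_gt_of_ne hi with h | h
    · have h1 : Real.exp (α * (C X i - m)) < 1 :=
        Real.exp_lt_one_iff.2 (mul_neg_of_pos_of_neg hα (by linarith))
      exact mul_pos_of_neg_of_neg (mul_neg_of_pos_of_neg hx (by linarith)) (by linarith)
    · have h1 : 1 < Real.exp (α * (C X i - m)) :=
        Real.one_lt_exp_iff.2 (mul_pos hα (by linarith))
      exact mul_pos (mul_pos hx (by linarith)) (by linarith)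
  obtain ⟨k, hk⟩ : ∃ k, C X k ≠ m := by
    by_contra! h
    apply hfix
    funext i
    rw [hT i, h i]
    simp
  have key : 0 < ∑ i, (hedge C α X i - X i) * (C X i - m) := by
    apply Finset.sum_pos'
    · intro i _
      by_cases h : C X i = m
      · simp [h]
      · exact (hpos i h).le
    · exact ⟨k, Finset.mem_univ k, hpos k hk⟩
  have e : ∑ i, (hedge C α X i - X i) * (C X i - m)
      = (∑ i, hedge C α X i * C X i - ∑ i, X i * C X i)
        - (∑ i, hedge C α X i - ∑ i, X i) * m := by
    rw [← Finset.sum_sub_distrib, ← Finset.sum_sub_distrib, Finset.sum_mul,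
      ← Finset.sum_sub_distrib]
    exact Finset.sum_congr rfl (fun i _ => by ring)
  rw [e, hT1, hsum] at key
  linarith
end

section
/- For every X in the relative interior of the probability simplex and every Y in the simplex, the function α ↦ RE(Y, T_α(X)) is a convex function of the learning rate α on [0, ∞); moreover it is strictly convex unless the coordinates (CX)_i, for i in the support of X, are all equal (i.e. unless X is a fixed point of Hedge). -/
/-- Relative entropy (Kullback–Leibler divergence) of `P` with respect to `Q`,
summed over the support of `P`. -/
noncomputable def RE {n : ℕ} (P Q : Fin n → ℝ) : ℝ :=
  ∑ i ∈ Finset.univ.filter fun i => 0 < P i, P i * Real.log (P i / Q i)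

theorem lse_key {n : ℕ} (X c : Fin n → ℝ) (hint : ∀ i, 0 < X i) (hne : Nonempty (Fin n))
    (x y a b : ℝ) (ha : 0 < a) (hb : 0 < b) (hab : a + b = 1) :
    Real.log (∑ j, X j * Real.exp ((a * x + b * y) * c j)) ≤
      a * Real.log (∑ j, X j * Real.exp (x * c j)) + b * Real.log (∑ j, X j * Real.exp (y * c j)) ∧
    (x ≠ y → (∃ i j, c i ≠ c j) →
      Real.log (∑ j, X j * Real.exp ((a * x + b * y) * c j)) <
      a * Real.log (∑ j, X j * Real.exp (x * c j)) +
        b * Real.log (∑ j, X j * Real.exp (y * c j))) := by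
  have hS : ∀ t : ℝ, 0 < ∑ j, X j * Real.exp (t * c j) := fun t =>
    Finset.sum_pos (fun j _ => mul_pos (hint j) (Real.exp_pos _)) Finset.univ_nonempty
  set A := Real.log (∑ j, X j * Real.exp (x * c j)) with hA
  set B := Real.log (∑ j, X j * Real.exp (y * c j)) with hB
  have e1 : ∀ t : ℝ, ∑ j, X j *
      Real.exp (t * c j - Real.log (∑ j, X j * Real.exp (t * c j))) = 1 := by
    intro t
    simp_rw [Real.exp_sub, Real.exp_log (hS t), ← mul_div_assoc]
    rw [← Finset.sum_div, div_self (hS t).ne']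
  have e2 : ∑ j, X j * (a * Real.exp (x * c j - A) + b * Real.exp (y * c j - B)) = 1 := by
    have h1 := e1 x
    have h2 := e1 y
    rw [← hA] at h1
    rw [← hB] at h2
    calc _ = a * ∑ j, X j * Real.exp (x * c j - A) + b * ∑ j, X j * Real.exp (y * c j - B) := by
          rw [Finset.mul_sum, Finset.mul_sum, ← Finset.sum_add_distrib]
          exact Finset.sum_congr rfl fun j _ => by ring
      _ = 1 := by rw [h1, h2]; linarith
  have e3 : ∑ j, X j * Real.exp (a * (x * c j - A) + b * (y * c j - B)) =
      (∑ j, X j * Real.exp ((a * x + b * y) * c j)) / Real.exp (a * A + b * B) := by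
    rw [Finset.sum_div]
    refine Finset.sum_congr rfl fun j _ => ?_
    rw [mul_div_assoc, ← Real.exp_sub]
    ring_nf
  have hle : ∀ j, X j * Real.exp (a * (x * c j - A) + b * (y * c j - B)) ≤
      X j * (a * Real.exp (x * c j - A) + b * Real.exp (y * c j - B)) := fun j =>
    mul_le_mul_of_nonneg_left
      (convexOn_exp.2 (Set.mem_univ _) (Set.mem_univ _) ha.le hb.le hab) (hint j).le
  constructor
  · rw [Real.log_le_iff_le_exp (hS _), ← div_le_one (Real.exp_pos _), ← e3, ← e2]
    exact Finset.sum_le_sum fun j _ => hle j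
  · rintro hxy ⟨i, j, hij⟩
    rw [Real.log_lt_iff_lt_exp (hS _), ← div_lt_one (Real.exp_pos _), ← e3, ← e2]
    have : ∃ k, x * c k - A ≠ y * c k - B := by
      by_contra! h
      have h1 := h i
      have h2 := h j
      have : (x - y) * (c i - c j) = 0 := by linarith
      rcases mul_eq_zero.1 this with h | h
      · exact hxy (sub_eq_zero.1 h)
      · exact hij (sub_eq_zero.1 h)
    obtain ⟨k, hk⟩ := this
    exact Finset.sum_lt_sum (fun j _ => hle j) ⟨k, Finset.mem_univ _,
      mul_lt_mul_of_pos_left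
        (strictConvexOn_exp.2 (Set.mem_univ _) (Set.mem_univ _) hk ha hb hab) (hint k)⟩

theorem RE_hedge_eq {n : ℕ} (C : (Fin n → ℝ) → (Fin n → ℝ))
    (X : Fin n → ℝ) (hint : ∀ i, 0 < X i) (hne : Nonempty (Fin n))
    (Y : Fin n → ℝ) (hY : Y ∈ stdSimplex ℝ (Fin n)) : ∃ K m : ℝ, ∀ α : ℝ,
    RE Y (hedge C α X) = K + α * m + Real.log (∑ j, X j * Real.exp (α * C X j)) := by
  refine ⟨∑ i ∈ Finset.univ.filter (fun i => 0 < Y i), Y i * (Real.log (Y i) - Real.log (X i)),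
    ∑ i ∈ Finset.univ.filter (fun i => 0 < Y i), - (Y i * C X i), fun α => ?_⟩
  have hS : 0 < ∑ j, X j * Real.exp (α * C X j) :=
    Finset.sum_pos (fun j _ => mul_pos (hint j) (Real.exp_pos _)) Finset.univ_nonempty
  have hsum : ∑ i ∈ Finset.univ.filter (fun i => 0 < Y i), Y i = 1 := by
    rw [← hY.2, Finset.sum_filter]
    refine Finset.sum_congr rfl fun i _ => ?_
    split_ifs with h
    · rfl
    · exact le_antisymm (hY.1 i) (not_lt.1 h)
  rw [← one_mul (Real.log (∑ j, X j * Real.exp (α * C X j))), ← hsum, Finset.sum_mul,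
    Finset.mul_sum, ← Finset.sum_add_distrib, ← Finset.sum_add_distrib]
  unfold RE hedge
  refine Finset.sum_congr rfl fun i hi => ?_
  have hYi : 0 < Y i := (Finset.mem_filter.1 hi).2
  have hXi := hint i
  have he := Real.exp_pos (α * C X i)
  rw [Real.log_div hYi.ne' (div_pos (mul_pos hXi he) hS).ne',
    Real.log_div (mul_pos hXi he).ne' hS.ne', Real.log_mul hXi.ne' he.ne', Real.log_exp]
  ring

/-- for `X` in the relative interior of the simplex and `Y` in the
simplex, `α ↦ RE(Y, T_α(X))` is convex on `[0,∞)`, and strictly convex unless the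
payoffs `(CX)_i` are constant over the support of `X` (i.e. unless `X` is a fixed
point of Hedge). -/
theorem hedge_relative_entropy_convex {n : ℕ}
    (C : (Fin n → ℝ) → (Fin n → ℝ)) (hC : ContinuousOn C (stdSimplex ℝ (Fin n)))
    (X : Fin n → ℝ) (hX : X ∈ stdSimplex ℝ (Fin n)) (hint : ∀ i, 0 < X i)
    (Y : Fin n → ℝ) (hY : Y ∈ stdSimplex ℝ (Fin n)) :
    ConvexOn ℝ (Set.Ici (0 : ℝ)) (fun α => RE Y (hedge C α X)) ∧
    (¬ (∀ i, 0 < X i → ∀ j, 0 < X j → C X i = C X j) →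
      StrictConvexOn ℝ (Set.Ici (0 : ℝ)) (fun α => RE Y (hedge C α X))) := by
  have hne : Nonempty (Fin n) := by
    by_contra h
    rw [not_nonempty_iff] at h
    have := hX.2
    simp at this
  obtain ⟨K, m, hK⟩ := RE_hedge_eq C X hint hne Y hY
  simp_rw [hK]
  constructor
  · rw [convexOn_iff_forall_pos]
    refine ⟨convex_Ici 0, fun x _ y _ a b ha hb hab => ?_⟩
    have h := (lse_key X (C X) hint hne x y a b ha hb hab).1
    have hk : K = a * K + b * K := by rw [← add_mul, hab, one_mul]
    simp only [smul_eq_mul]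
    linarith
  · intro hc
    refine ⟨convex_Ici 0, fun x _ y _ hxy a b ha hb hab => ?_⟩
    have hc' : ∃ i j, C X i ≠ C X j := by
      by_contra! h
      exact hc fun i _ j _ => h i j
    have h := (lse_key X (C X) hint hne x y a b ha hb hab).2 hxy hc'
    have hk : K = a * K + b * K := by rw [← add_mul, hab, one_mul]
    simp only [smul_eq_mul]
    linarith
end

section
/- Let X lie in the relative interior of the probability simplex, assume X is not a fixed point of the Hedge map, and let Y ∈ 𝕏 be a best response to X (i.e. Y·CX = maxᵢ (CX)_i). Then for every learning rate α > 0, RE(Y, T_α(X)) < RE(Y, X). -/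
/-- if `X` is in the relative interior of the simplex, `X` is not a
fixed point of the Hedge map, and `Y` is a best response to `X`, then for every
learning rate `α > 0`, `RE(Y, T_α(X)) < RE(Y, X)`. -/
theorem hedge_decreases_entropy_to_best_response {n : ℕ}
    (C : (Fin n → ℝ) → (Fin n → ℝ)) (hC : ContinuousOn C (stdSimplex ℝ (Fin n)))
    (X : Fin n → ℝ) (hX : X ∈ stdSimplex ℝ (Fin n)) (hint : ∀ i, 0 < X i)
    (hfix : ¬ ∀ α > (0 : ℝ), hedge C α X = X)
    (Y : Fin n → ℝ) (hY : Y ∈ stdSimplex ℝ (Fin n))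
    (hbr : ∀ Z ∈ stdSimplex ℝ (Fin n), ∑ i, Z i * C X i ≤ ∑ i, Y i * C X i) :
    ∀ α > (0 : ℝ), RE Y (hedge C α X) < RE Y X := by
  intro α hα
  obtain ⟨hX0, hX1⟩ := hX
  obtain ⟨hY0, hY1⟩ := hY
  set M := ∑ i, Y i * C X i with hM
  have hle : ∀ i, C X i ≤ M := by
    intro i
    have h := hbr (Pi.single i 1) (single_mem_stdSimplex ℝ i)
    simpa [Pi.single_apply] using h
  have hlt : ∃ k, C X k < M := by
    by_contra hcon
    push Not at hcon
    have heq : ∀ i, C X i = M := fun i => le_antisymm (hle i) (hcon i)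
    apply hfix
    intro β _
    funext i
    simp only [hedge, heq]
    rw [← Finset.sum_mul, hX1, one_mul, mul_div_assoc, div_self (Real.exp_ne_zero _), mul_one]
  obtain ⟨k, hk⟩ := hlt
  set S := ∑ j, X j * Real.exp (α * C X j) with hS
  have hSpos : 0 < S :=
    Finset.sum_pos (fun i _ => mul_pos (hint i) (Real.exp_pos _)) ⟨k, Finset.mem_univ k⟩
  have hSlt : S < Real.exp (α * M) := by
    have h : S < ∑ j, X j * Real.exp (α * M) := by
      apply Finset.sum_lt_sum
      · intro i _
        exact mul_le_mul_of_nonneg_left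
          (Real.exp_le_exp.2 (mul_le_mul_of_nonneg_left (hle i) hα.le)) (hX0 i)
      · exact ⟨k, Finset.mem_univ k, mul_lt_mul_of_pos_left
          (Real.exp_lt_exp.2 (mul_lt_mul_of_pos_left hk hα)) (hint k)⟩
    rwa [← Finset.sum_mul, hX1, one_mul] at h
  have hlog : Real.log S < α * M := by
    rwa [Real.log_lt_iff_lt_exp hSpos]
  have hsum : ∀ f : Fin n → ℝ,
      ∑ i ∈ Finset.univ.filter (fun i => 0 < Y i), Y i * f i = ∑ i, Y i * f i := by
    intro f
    apply Finset.sum_filter_of_ne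
    intro i _ h
    exact lt_of_le_of_ne (hY0 i) (fun h0 => h (by rw [← h0, zero_mul]))
  have hdiff : RE Y X - RE Y (hedge C α X) = α * M - Real.log S := by
    have h1 : RE Y X - RE Y (hedge C α X) =
        ∑ i ∈ Finset.univ.filter (fun i => 0 < Y i), Y i * (α * C X i - Real.log S) := by
      unfold RE
      rw [← Finset.sum_sub_distrib]
      apply Finset.sum_congr rfl
      intro i hi
      have hYi : 0 < Y i := (Finset.mem_filter.1 hi).2
      have hXi := hint i
      have he := Real.exp_pos (α * C X i)
      have hh : hedge C α X i = X i * Real.exp (α * C X i) / S := rfl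
      rw [hh, Real.log_div hYi.ne' hXi.ne',
        Real.log_div hYi.ne' (div_pos (mul_pos hXi he) hSpos).ne',
        Real.log_div (mul_pos hXi he).ne' hSpos.ne', Real.log_mul hXi.ne' he.ne', Real.log_exp]
      ring
    rw [h1, hsum (fun i => α * C X i - Real.log S)]
    simp only [mul_sub, Finset.sum_sub_distrib]
    rw [← Finset.sum_mul, hY1, one_mul, hM, Finset.mul_sum]
    congr 1
    exact Finset.sum_congr rfl (fun i _ => by ring)
  linarith
end

section
/- Let Y, X be points of the probability simplex with the support of Y contained in the support of X and Y ≠ X, and suppose X is not a fixed point of Hedge (i.e. the coordinates (CX)_i, for i in the support of X, are not all equal). If X·CX − Y·CX ≥ 0, then for every learning rate α > 0, RE(Y, T_α(X)) − RE(Y, X) > 0. -/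
/-- let `Y, X` be points of the simplex with `supp Y ⊆ supp X` and
`Y ≠ X`, and suppose `X` is not a fixed point of Hedge (the payoffs `(CX)_i` are
not all equal on the support of `X`).  If `X·CX − Y·CX ≥ 0`, then for every
learning rate `α > 0`, `RE(Y, T_α(X)) − RE(Y, X) > 0`. -/
theorem hedge_instability {n : ℕ}
    (C : (Fin n → ℝ) → (Fin n → ℝ)) (hC : ContinuousOn C (stdSimplex ℝ (Fin n)))
    (Y X : Fin n → ℝ) (hY : Y ∈ stdSimplex ℝ (Fin n)) (hX : X ∈ stdSimplex ℝ (Fin n))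
    (hsupp : ∀ i, 0 < Y i → 0 < X i) (hne : Y ≠ X)
    (hfix : ¬ ∀ i, 0 < X i → ∀ j, 0 < X j → C X i = C X j)
    (hdom : 0 ≤ ∑ i, X i * C X i - ∑ i, Y i * C X i) :
    ∀ α > (0 : ℝ), 0 < RE Y (hedge C α X) - RE Y X := by
  intro α hα
  obtain ⟨hX0, hX1⟩ := hX
  obtain ⟨hY0, hY1⟩ := hY
  set c := C X with hc
  set m := ∑ i, X i * c i with hm
  set S := ∑ j, X j * Real.exp (α * c j) with hS
  have hex : ∃ i, 0 < X i ∧ c i ≠ m := by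
    by_contra h
    push Not at h
    exact hfix fun i hi j hj => (h i hi).trans (h j hj).symm
  have hsum : ∑ i, X i * (1 + α * (c i - m)) = 1 := by
    have h1 : ∀ i, X i * (1 + α * (c i - m)) = (1 - α * m) * X i + α * (X i * c i) := by
      intro i; ring
    simp only [h1]
    rw [Finset.sum_add_distrib, ← Finset.mul_sum, ← Finset.mul_sum, hX1, ← hm]
    ring
  have hlt : 1 < ∑ i, X i * Real.exp (α * (c i - m)) := by
    rw [← hsum]
    apply Finset.sum_lt_sum
    · intro i _
      apply mul_le_mul_of_nonneg_left _ (hX0 i)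
      linarith [Real.add_one_le_exp (α * (c i - m))]
    · obtain ⟨i, hi, hne'⟩ := hex
      refine ⟨i, Finset.mem_univ i, ?_⟩
      apply mul_lt_mul_of_pos_left _ hi
      linarith [Real.add_one_lt_exp (mul_ne_zero hα.ne' (sub_ne_zero.mpr hne'))]
  have hSe : S = Real.exp (α * m) * ∑ i, X i * Real.exp (α * (c i - m)) := by
    rw [hS, Finset.mul_sum]
    refine Finset.sum_congr rfl fun i _ => ?_
    rw [mul_left_comm, ← Real.exp_add]
    congr 2
    ring
  have hSgt : Real.exp (α * m) < S := by
    rw [hSe]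
    exact lt_mul_of_one_lt_right (Real.exp_pos _) hlt
  have hSpos : 0 < S := (Real.exp_pos _).trans hSgt
  have hlog : α * m < Real.log S := (Real.lt_log_iff_exp_lt hSpos).mpr hSgt
  have hdiff : RE Y (hedge C α X) - RE Y X = Real.log S - α * ∑ i, Y i * c i := by
    unfold RE
    rw [← Finset.sum_sub_distrib, Finset.sum_filter]
    have h2 : ∀ i, (if 0 < Y i then Y i * Real.log (Y i / hedge C α X i)
        - Y i * Real.log (Y i / X i) else 0) = Real.log S * Y i - α * (Y i * c i) := by
      intro i
      split_ifs with h
      · have hxi := hsupp i h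
        have he : hedge C α X i = X i * Real.exp (α * c i) / S := rfl
        have hp : 0 < X i * Real.exp (α * c i) := mul_pos hxi (Real.exp_pos _)
        rw [he, Real.log_div h.ne' (div_pos hp hSpos).ne', Real.log_div hp.ne' hSpos.ne',
          Real.log_mul hxi.ne' (Real.exp_pos _).ne', Real.log_exp, Real.log_div h.ne' hxi.ne']
        ring
      · have : Y i = 0 := le_antisymm (not_lt.mp h) (hY0 i)
        simp [this]
    simp only [h2]
    rw [Finset.sum_sub_distrib, ← Finset.mul_sum, ← Finset.mul_sum, hY1, mul_one]
  rw [hdiff]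
  have := mul_nonneg hα.le hdom
  rw [mul_sub] at this
  linarith
end

section
/- Let C : 𝕏 → ℝⁿ be a continuous payoff operator on the probability simplex with all payoffs in [0, 1] (i.e. 0 ≤ (CX)_i ≤ 1 for all X and i). Then there exists a constant C̄ > 0, independent of X and Y, such that for every Y ∈ 𝕏, every X in the relative interior of 𝕏, and every α > 0: RE(Y, T_α(X)) ≤ RE(Y, X) − α·(Y − X)·CX + α·(exp(α) − 1)·C̄. -/
/-- for a continuous payoff operator with payoffs in `[0,1]` there is
a constant `C̄ > 0`, independent of `X` and `Y`, such that for every `Y` in the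
simplex, every `X` in its relative interior and every `α > 0`,
`RE(Y, T_α(X)) ≤ RE(Y, X) − α (Y−X)·CX + α (e^α − 1) C̄`. -/
theorem hedge_entropy_descent_bound {n : ℕ}
    (C : (Fin n → ℝ) → (Fin n → ℝ)) (hC : ContinuousOn C (stdSimplex ℝ (Fin n)))
    (hrange : ∀ X ∈ stdSimplex ℝ (Fin n), ∀ i, C X i ∈ Set.Icc (0 : ℝ) 1) :
    ∃ Cbar > (0 : ℝ), ∀ Y ∈ stdSimplex ℝ (Fin n), ∀ X ∈ stdSimplex ℝ (Fin n),
      (∀ i, 0 < X i) → ∀ α > (0 : ℝ),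
        RE Y (hedge C α X) ≤
          RE Y X - α * (∑ i, (Y i - X i) * C X i) + α * (Real.exp α - 1) * Cbar := by
  refine ⟨1, one_pos, ?_⟩
  intro Y hY X hX hXpos α hα
  set c := C X with hc
  have hc0 : ∀ i, 0 ≤ c i := fun i => (hrange X hX i).1
  have hc1 : ∀ i, c i ≤ 1 := fun i => (hrange X hX i).2
  set Z := ∑ j, X j * Real.exp (α * c j) with hZ
  set m := ∑ j, X j * c j with hm
  have hne : (Finset.univ : Finset (Fin n)).Nonempty := by
    by_contra h
    rw [Finset.not_nonempty_iff_eq_empty] at h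
    have := hX.2
    rw [h] at this
    simp at this
  have hZpos : 0 < Z := Finset.sum_pos (fun j _ => mul_pos (hXpos j) (Real.exp_pos _)) hne
  have hm1 : m ≤ 1 := by
    rw [← hX.2]
    exact Finset.sum_le_sum fun j _ => mul_le_of_le_one_right (hXpos j).le (hc1 j)
  have hexp : ∀ j, Real.exp (α * c j) ≤ 1 + α * c j * Real.exp α := by
    intro j
    have h1 := Real.add_one_le_exp (-(α * c j))
    have h2 : Real.exp (-(α * c j)) * Real.exp (α * c j) = 1 := by
      rw [← Real.exp_add]; simp
    have h3 : Real.exp (α * c j) ≤ Real.exp α :=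
      Real.exp_le_exp.2 (mul_le_of_le_one_right hα.le (hc1 j))
    have h4 := mul_le_mul_of_nonneg_right h1 (Real.exp_pos (α * c j)).le
    have h5 := mul_le_mul_of_nonneg_left h3 (mul_nonneg hα.le (hc0 j))
    nlinarith
  have hZle : Z ≤ 1 + α * m * Real.exp α := by
    calc Z ≤ ∑ j, (X j + α * Real.exp α * (X j * c j)) := by
          refine Finset.sum_le_sum fun j _ => ?_
          have := mul_le_mul_of_nonneg_left (hexp j) (hXpos j).le
          linarith
      _ = 1 + α * m * Real.exp α := by
          rw [Finset.sum_add_distrib, hX.2, ← Finset.mul_sum]; ring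
  have hlog : Real.log Z ≤ α * m + α * (Real.exp α - 1) := by
    have h1 := Real.log_le_sub_one_of_pos hZpos
    have h2 : 0 ≤ α * (Real.exp α - 1) :=
      mul_nonneg hα.le (by linarith [Real.add_one_le_exp α])
    have h3 := mul_le_mul_of_nonneg_right hm1 h2
    nlinarith
  have hfull : ∀ f : Fin n → ℝ,
      ∑ i ∈ Finset.univ.filter (fun i => 0 < Y i), Y i * f i = ∑ i, Y i * f i := by
    intro f
    refine Finset.sum_filter_of_ne fun i _ h => ?_
    exact lt_of_le_of_ne (hY.1 i) (fun h0 => h (by rw [← h0, zero_mul]))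
  have hRE : RE Y (hedge C α X) = RE Y X - α * (∑ i, Y i * c i) + Real.log Z := by
    have e1 : RE Y (hedge C α X) = RE Y X
        + ∑ i ∈ Finset.univ.filter (fun i => 0 < Y i), Y i * (Real.log Z - α * c i) := by
      unfold RE
      rw [← Finset.sum_add_distrib]
      refine Finset.sum_congr rfl fun i hi => ?_
      have hYi : 0 < Y i := (Finset.mem_filter.1 hi).2
      have hh : hedge C α X i = X i * Real.exp (α * c i) / Z := rfl
      have hXe := mul_pos (hXpos i) (Real.exp_pos (α * c i))
      rw [hh, Real.log_div hYi.ne' (div_pos hXe hZpos).ne', Real.log_div hXe.ne' hZpos.ne',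
        Real.log_mul (hXpos i).ne' (Real.exp_pos _).ne', Real.log_exp,
        Real.log_div hYi.ne' (hXpos i).ne']
      ring
    rw [e1, hfull]
    have e2 : ∑ i, Y i * (Real.log Z - α * c i) = Real.log Z - α * ∑ i, Y i * c i := by
      rw [Finset.mul_sum]
      simp only [mul_sub, Finset.sum_sub_distrib]
      rw [← Finset.sum_mul, hY.2, one_mul]
      congr 1
      exact Finset.sum_congr rfl fun i _ => by ring
    rw [e2]; ring
  have hs : ∑ i, (Y i - X i) * c i = ∑ i, Y i * c i - m := by
    simp only [sub_mul, Finset.sum_sub_distrib, hm]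
  rw [hRE, hs]
  linarith
end

section
/- Let C : 𝕏 → ℝⁿ be a continuous payoff operator on the probability simplex with all payoffs in [0, 1]. Fix X⁰ in the relative interior of 𝕏 and define X^{k+1} = T_{α_k}(X^k), where the learning rates α_k > 0 satisfy α_k → 0 and ∑_{k=0}^∞ α_k = +∞. Then for every Y ∈ 𝕏, liminf_{k→∞} (Y − X^k)·CX^k ≤ 0. -/
open Filter

/-- for a continuous payoff operator with payoffs in `[0,1]`, Hedge
iterates `X^{k+1} = T_{α_k}(X^k)` started in the relative interior of the simplex,
with learning rates `α_k > 0`, `α_k → 0`, `∑ α_k = +∞`, satisfy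
`liminf_k (Y − X^k)·CX^k ≤ 0` for every `Y` in the simplex. -/
theorem hedge_liminf_nonpositive {n : ℕ}
    (C : (Fin n → ℝ) → (Fin n → ℝ)) (hC : ContinuousOn C (stdSimplex ℝ (Fin n)))
    (hrange : ∀ X ∈ stdSimplex ℝ (Fin n), ∀ i, C X i ∈ Set.Icc (0 : ℝ) 1)
    (α : ℕ → ℝ) (hαpos : ∀ k, 0 < α k)
    (hα0 : Tendsto α atTop (nhds 0))
    (hαdiv : Tendsto (fun K => ∑ k ∈ Finset.range K, α k) atTop atTop)
    (X : ℕ → Fin n → ℝ) (hX0 : X 0 ∈ stdSimplex ℝ (Fin n)) (hX0int : ∀ i, 0 < X 0 i)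
    (hrec : ∀ k, X (k + 1) = hedge C (α k) (X k)) :
    ∀ Y ∈ stdSimplex ℝ (Fin n),
      Filter.liminf (fun k => ∑ i, (Y i - X k i) * C (X k) i) atTop ≤ 0 := by
  intro Y hY
  have hZpos : ∀ k, (∀ i, 0 < X k i) → X k ∈ stdSimplex ℝ (Fin n) →
      0 < ∑ j, X k j * Real.exp (α k * C (X k) j) := by
    intro k hp hk
    have hne : (Finset.univ : Finset (Fin n)).Nonempty := by
      rw [Finset.nonempty_iff_ne_empty]
      intro h
      have := hk.2
      rw [h] at this
      simp at this
    exact Finset.sum_pos (fun j _ => mul_pos (hp j) (Real.exp_pos _)) hne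
  have hX : ∀ k, (∀ i, 0 < X k i) ∧ X k ∈ stdSimplex ℝ (Fin n) := by
    intro k
    induction k with
    | zero => exact ⟨hX0int, hX0⟩
    | succ k ih =>
      have hZ := hZpos k ih.1 ih.2
      have hp : ∀ i, 0 < X (k + 1) i := by
        intro i
        rw [hrec k]
        exact div_pos (mul_pos (ih.1 i) (Real.exp_pos _)) hZ
      refine ⟨hp, fun i => (hp i).le, ?_⟩
      rw [hrec k]
      simp only [hedge]
      rw [← Finset.sum_div]
      exact div_self hZ.ne'
  have hL0 : ∀ k, ∑ i, Y i * Real.log (X k i) ≤ 0 := by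
    intro k
    refine Finset.sum_nonpos fun i _ => mul_nonpos_of_nonneg_of_nonpos (hY.1 i) ?_
    refine Real.log_nonpos ((hX k).1 i).le ?_
    rw [← (hX k).2.2]
    exact Finset.single_le_sum (f := X k) (fun j _ => ((hX k).1 j).le) (Finset.mem_univ i)
  have hstep : ∀ k, α k ≤ 1 →
      α k * (∑ i, (Y i - X k i) * C (X k) i - α k) ≤
      ∑ i, Y i * Real.log (X (k + 1) i) - ∑ i, Y i * Real.log (X k i) := by
    intro k h1
    have hZ := hZpos k (hX k).1 (hX k).2
    have hCr := hrange _ (hX k).2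
    have ha := hαpos k
    set Z := ∑ j, X k j * Real.exp (α k * C (X k) j) with hZdef
    have hZle : Z ≤ 1 + α k * ∑ i, X k i * C (X k) i + α k ^ 2 := by
      have : ∀ j ∈ Finset.univ, X k j * Real.exp (α k * C (X k) j) ≤
          X k j + α k * (X k j * C (X k) j) + X k j * α k ^ 2 := by
        intro j _
        have hc := hCr j
        have hx0 : 0 ≤ α k * C (X k) j := mul_nonneg ha.le hc.1
        have hx1 : α k * C (X k) j ≤ α k := mul_le_of_le_one_right ha.le hc.2
        have hb := Real.abs_exp_sub_one_sub_id_le (x := α k * C (X k) j)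
          (by rw [abs_of_nonneg hx0]; linarith)
        have hb' := (abs_le.1 hb).2
        have hsq : (α k * C (X k) j) ^ 2 ≤ α k ^ 2 := pow_le_pow_left₀ hx0 hx1 2
        have := mul_le_mul_of_nonneg_left
          (show Real.exp (α k * C (X k) j) ≤ 1 + α k * C (X k) j + α k ^ 2 by linarith)
          ((hX k).1 j).le
        linarith
      refine (Finset.sum_le_sum this).trans (le_of_eq ?_)
      rw [Finset.sum_add_distrib, Finset.sum_add_distrib, ← Finset.mul_sum, ← Finset.sum_mul,
        (hX k).2.2, one_mul]
    have hlog : Real.log Z ≤ α k * ∑ i, X k i * C (X k) i + α k ^ 2 := by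
      have := Real.log_le_sub_one_of_pos hZ
      linarith
    have hlogX : ∀ i, Real.log (X (k + 1) i) =
        Real.log (X k i) + α k * C (X k) i - Real.log Z := by
      intro i
      rw [hrec k]
      simp only [hedge]
      rw [Real.log_div (mul_pos ((hX k).1 i) (Real.exp_pos _)).ne' hZ.ne',
        Real.log_mul ((hX k).1 i).ne' (Real.exp_pos _).ne', Real.log_exp]
    have hsum : ∑ i, Y i * Real.log (X (k + 1) i) =
        ∑ i, Y i * Real.log (X k i) + α k * ∑ i, Y i * C (X k) i - Real.log Z := by
      have : ∀ i, Y i * Real.log (X (k + 1) i) =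
          Y i * Real.log (X k i) + α k * (Y i * C (X k) i) - Y i * Real.log Z := by
        intro i
        rw [hlogX i]
        ring
      simp only [this]
      rw [Finset.sum_sub_distrib, Finset.sum_add_distrib, ← Finset.mul_sum, ← Finset.sum_mul,
        hY.2, one_mul]
    have hg : ∑ i, (Y i - X k i) * C (X k) i =
        ∑ i, Y i * C (X k) i - ∑ i, X k i * C (X k) i := by
      simp only [sub_mul]
      rw [Finset.sum_sub_distrib]
    rw [hsum, hg]
    linarith
  rw [Filter.liminf_eq]
  refine Real.sSup_nonpos fun c hc => ?_
  by_contra hc0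
  push Not at hc0
  have hc : ∀ᶠ k in atTop, c ≤ ∑ i, (Y i - X k i) * C (X k) i := hc
  have hs : ∀ᶠ k in atTop, α k < min 1 (c / 2) :=
    hα0.eventually_lt_const (lt_min one_pos (half_pos hc0))
  obtain ⟨N, hN⟩ := eventually_atTop.1 (hc.and hs)
  have hmono : ∀ m, N ≤ m → c / 2 * (∑ k ∈ Finset.range m, α k - ∑ k ∈ Finset.range N, α k) ≤
      ∑ i, Y i * Real.log (X m i) - ∑ i, Y i * Real.log (X N i) := by
    intro m hm
    induction m, hm using Nat.le_induction with
    | base => simp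
    | succ m hm ih =>
      obtain ⟨h1, h2⟩ := hN m hm
      have h3 := hstep m (h2.le.trans (min_le_left _ _))
      have h4 := h2.le.trans (min_le_right _ _)
      have h5 := mul_le_mul_of_nonneg_left
        (show c / 2 ≤ ∑ i, (Y i - X m i) * C (X m) i - α m by linarith) (hαpos m).le
      rw [Finset.sum_range_succ]
      linarith
  obtain ⟨m, hm1, hm2⟩ := ((eventually_ge_atTop N).and (hαdiv.eventually_gt_atTop
    (∑ k ∈ Finset.range N, α k + (-∑ i, Y i * Real.log (X N i)) / (c / 2)))).exists
  have h1 := hmono m hm1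
  have h2 := hL0 m
  have h3 : (-∑ i, Y i * Real.log (X N i)) / (c / 2) <
      ∑ k ∈ Finset.range m, α k - ∑ k ∈ Finset.range N, α k := by linarith
  rw [div_lt_iff₀ (half_pos hc0)] at h3
  linarith
end

section
/- Let C be an n×n real matrix and let X* ∈ 𝕏 be a fixed point of the Hedge map that is not a symmetric Nash equilibrium strategy of (C, Cᵀ). Then for every learning rate α > 0, X* is repelling under T_α: for every X⁰ in the relative interior of 𝕏, the iterates T_α^k(X⁰) do not converge to X*. -/
open Filter

/-- if `Xstar` is a fixed point of the Hedge map for the symmetric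
bimatrix game `(C, Cᵀ)` but not a symmetric Nash equilibrium strategy, then for
every learning rate `α > 0`, `Xstar` is repelling: no Hedge orbit started in the
relative interior of the simplex converges to `Xstar`. -/
theorem nonequilibrium_fixed_points_repelling {n : ℕ}
    (C : Matrix (Fin n) (Fin n) ℝ) (Xstar : Fin n → ℝ)
    (hXstar : Xstar ∈ stdSimplex ℝ (Fin n))
    (hfix : ∀ α > (0 : ℝ), hedge (fun X => C.mulVec X) α Xstar = Xstar)
    (hnotNE : ¬ ∀ X ∈ stdSimplex ℝ (Fin n),
      0 ≤ ∑ i, (Xstar i - X i) * C.mulVec Xstar i) :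
    ∀ α > (0 : ℝ), ∀ X0 ∈ stdSimplex ℝ (Fin n), (∀ i, 0 < X0 i) →
      ¬ Tendsto (fun k => (hedge (fun X => C.mulVec X) α)^[k] X0) atTop
          (nhds Xstar) := by
  intro α hα X0 hX0 hpos htend
  have hnn := hXstar.1
  have hsum := hXstar.2
  set c := C.mulVec Xstar with hc
  -- payoffs agree on the support
  have hsupp : ∀ i, 0 < Xstar i → Real.exp (c i) = ∑ j, Xstar j * Real.exp (c j) := by
    intro i hi
    have h := congrFun (hfix 1 one_pos) i
    simp only [hedge, one_mul, ← hc] at h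
    have hS : (∑ j, Xstar j * Real.exp (c j)) ≠ 0 := by
      intro h0
      rw [h0, div_zero] at h
      exact hi.ne h
    rw [div_eq_iff hS] at h
    exact mul_left_cancel₀ hi.ne' h
  obtain ⟨i, hi⟩ : ∃ i, 0 < Xstar i := by
    by_contra hcon
    push Not at hcon
    have : ∑ i, Xstar i ≤ 0 := Finset.sum_nonpos (fun i _ => hcon i)
    linarith
  have heq : ∀ j, 0 < Xstar j → c j = c i := by
    intro j hj
    exact Real.exp_injective ((hsupp j hj).trans (hsupp i hi).symm)
  obtain ⟨j, hj⟩ : ∃ j, c i < c j := by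
    by_contra hcon
    push Not at hcon
    apply hnotNE
    intro X hX
    have h1 : ∑ k, Xstar k * c k = c i := by
      have : ∀ k, Xstar k * c k = Xstar k * c i := by
        intro k
        rcases (hnn k).eq_or_lt with h | h
        · rw [← h]; simp
        · rw [heq k h]
      simp_rw [this]
      rw [← Finset.sum_mul, hsum, one_mul]
    have h2 : ∑ k, X k * c k ≤ c i := by
      calc ∑ k, X k * c k ≤ ∑ k, X k * c i :=
            Finset.sum_le_sum (fun k _ => mul_le_mul_of_nonneg_left (hcon k) (hX.1 k))
        _ = c i := by rw [← Finset.sum_mul, hX.2, one_mul]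
    simp_rw [sub_mul]
    rw [Finset.sum_sub_distrib]
    linarith
  set T := hedge (fun X => C.mulVec X) α with hT
  have hSpos : ∀ X : Fin n → ℝ, (∀ k, 0 < X k) →
      0 < ∑ k, X k * Real.exp (α * C.mulVec X k) := fun X hX =>
    Finset.sum_pos (fun k _ => mul_pos (hX k) (Real.exp_pos _)) ⟨i, Finset.mem_univ i⟩
  have hposk : ∀ k : ℕ, ∀ l, 0 < (T^[k] X0) l := by
    intro k
    induction k with
    | zero => exact hpos
    | succ k ih =>
      intro l
      rw [Function.iterate_succ_apply']
      exact div_pos (mul_pos (ih l) (Real.exp_pos _)) (hSpos _ ih)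
  have hcont : Continuous (fun X : Fin n → ℝ => C.mulVec X) := by fun_prop
  have hct := (hcont.tendsto Xstar).comp htend
  rw [tendsto_pi_nhds] at hct
  have hev := (hct i).eventually_lt (hct j) hj
  obtain ⟨N, hN⟩ := eventually_atTop.1 hev
  set r := (T^[N] X0) j / (T^[N] X0) i with hr
  have hrpos : 0 < r := div_pos (hposk N j) (hposk N i)
  have hbound : ∀ k ≥ N, r * (T^[k] X0) i ≤ (T^[k] X0) j := by
    intro k hk
    induction k, hk using Nat.le_induction with
    | base => rw [hr, div_mul_cancel₀ _ (hposk N i).ne']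
    | succ k hk ih =>
      rw [Function.iterate_succ_apply']
      have hlt : C.mulVec (T^[k] X0) i < C.mulVec (T^[k] X0) j := hN k hk
      have hp := hposk k
      generalize T^[k] X0 = Y at ih hlt hp
      have hS := hSpos Y hp
      simp only [hT, hedge]
      rw [← mul_div_assoc, ← mul_assoc]
      refine div_le_div_of_nonneg_right ?_ hS.le
      refine mul_le_mul ih ?_ (Real.exp_pos _).le (hp j).le
      exact Real.exp_le_exp.2 (mul_le_mul_of_nonneg_left hlt.le hα.le)
  rw [tendsto_pi_nhds] at htend
  have hlim : r * Xstar i ≤ Xstar j :=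
    le_of_tendsto_of_tendsto ((htend i).const_mul r) (htend j)
      (eventually_atTop.2 ⟨N, hbound⟩)
  have hj0 : 0 < Xstar j := lt_of_lt_of_le (mul_pos hrpos hi) hlim
  exact hj.ne' (heq j hj0)
end
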